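/- For every erasure probability ε ∈ [0,1] and every integer n_T ≥ K, the PMF is nonnegative: f_ε(n_T) ≥ 0. -/

import Mathlib

open Finset

/-- Decoding probability P(n_R, K) = ∏_{i=0}^{K−1} (1 − q^{−(n_R − i)}). -/
noncomputable def Pdec (q K nR : ℕ) : ℝ :=
  ∏ i ∈ Finset.range K, (1 - (q : ℝ) ^ (-((nR : ℤ) - (i : ℤ))))

/-- CDF F_ε(n_T) = ∑_{n_R=K}^{n_T} C(n_T,n_R) (1−ε)^{n_R} ε^{n_T−n_R} P(n_R,K). -/
noncomputable def Fcdf (q K : ℕ) (ε : ℝ) (nT : ℕ) : ℝ :=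
  ∑ nR ∈ Finset.Icc K nT,
    (nT.choose nR : ℝ) * (1 - ε) ^ nR * ε ^ (nT - nR) * Pdec q K nR

/-- PMF f_ε(n_T) = F_ε(n_T) − F_ε(n_T−1) for n_T > K, and f_ε(K) = F_ε(K). -/
noncomputable def fpmf (q K : ℕ) (ε : ℝ) (nT : ℕ) : ℝ :=
  if nT = K then Fcdf q K ε K else Fcdf q K ε nT - Fcdf q K ε (nT - 1)

/-- Intercept probability of feedback-aided transmission. -/
noncomputable def PFT (q K : ℕ) (εB εE : ℝ) (N : ℕ) : ℝ :=
  (∑ nT ∈ Finset.Icc K N, fpmf q K εB nT * Fcdf q K εE nT)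
    + Fcdf q K εE N * (1 - Fcdf q K εB N)

/-- Intercept probability of unaided transmission. -/
noncomputable def PUT (q K : ℕ) (εE : ℝ) (N : ℕ) : ℝ := Fcdf q K εE N

theorem Pdec_eq_zero {q K n : ℕ} (h : n < K) : Pdec q K n = 0 :=
  Finset.prod_eq_zero (Finset.mem_range.2 h) (by simp)

theorem Pdec_factor_nonneg {q n i : ℕ} (hq : 1 ≤ q) (h : i ≤ n) :
    0 ≤ 1 - (q : ℝ) ^ (-((n : ℤ) - (i : ℤ))) :=
  sub_nonneg.2 (zpow_le_one_of_nonpos₀ (by exact_mod_cast hq) (by omega))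

theorem Pdec_nonneg {q : ℕ} (hq : 1 ≤ q) (K n : ℕ) : 0 ≤ Pdec q K n := by
  rcases lt_or_ge n K with h | h
  · rw [Pdec_eq_zero h]
  · exact Finset.prod_nonneg fun i hi ↦
      Pdec_factor_nonneg hq ((Finset.mem_range.1 hi).le.trans h)

theorem Pdec_le_succ {q : ℕ} (hq : 1 ≤ q) (K n : ℕ) : Pdec q K n ≤ Pdec q K (n + 1) := by
  rcases lt_or_ge n K with h | h
  · rw [Pdec_eq_zero h]
    exact Pdec_nonneg hq K (n + 1)
  · refine Finset.prod_le_prod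
      (fun i hi ↦ Pdec_factor_nonneg hq ((Finset.mem_range.1 hi).le.trans h)) fun i _ ↦ ?_
    have : (1 : ℝ) ≤ q := by exact_mod_cast hq
    exact sub_le_sub_left (zpow_le_zpow_right₀ this (by push_cast; omega)) 1

theorem Fcdf_eq_sum_range (q K : ℕ) (ε : ℝ) (n : ℕ) :
    Fcdf q K ε n = ∑ k ∈ Finset.range (n + 1),
      (n.choose k : ℝ) * (1 - ε) ^ k * ε ^ (n - k) * Pdec q K k := by
  refine Finset.sum_subset (fun k hk ↦ ?_) fun k hk hk' ↦ ?_
  · simp only [Finset.mem_Icc, Finset.mem_range] at *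
    omega
  · simp only [Finset.mem_Icc, Finset.mem_range] at *
    rw [Pdec_eq_zero (by omega), mul_zero]

/-- Conditioning a binomial expectation on the last trial. -/
theorem sum_choose_mul_succ (p ε : ℝ) (g : ℕ → ℝ) (n : ℕ) :
    ∑ k ∈ Finset.range (n + 2), ((n + 1).choose k : ℝ) * p ^ k * ε ^ (n + 1 - k) * g k =
      ε * ∑ k ∈ Finset.range (n + 1), (n.choose k : ℝ) * p ^ k * ε ^ (n - k) * g k +
      p * ∑ k ∈ Finset.range (n + 1), (n.choose k : ℝ) * p ^ k * ε ^ (n - k) * g (k + 1) := by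
  have h : ε * ∑ k ∈ Finset.range (n + 1), (n.choose k : ℝ) * p ^ k * ε ^ (n - k) * g k =
      ∑ k ∈ Finset.range (n + 2), (n.choose k : ℝ) * p ^ k * ε ^ (n + 1 - k) * g k := by
    rw [Finset.sum_range_succ _ (n + 1), Nat.choose_succ_self, Finset.mul_sum]
    simp only [Nat.cast_zero, zero_mul, add_zero]
    refine Finset.sum_congr rfl fun k hk ↦ ?_
    rw [Nat.succ_sub (Nat.lt_succ_iff.1 (Finset.mem_range.1 hk)), pow_succ]
    ring
  rw [h, Finset.sum_range_succ', Finset.sum_range_succ' _ (n + 1), Finset.mul_sum,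
    add_right_comm, ← Finset.sum_add_distrib]
  simp only [Nat.choose_zero_right]
  congr 1
  refine Finset.sum_congr rfl fun k _ ↦ ?_
  rw [Nat.choose_succ_succ, Nat.add_sub_add_right]
  push_cast
  ring

theorem Fcdf_nonneg {q : ℕ} (hq : 1 ≤ q) (K : ℕ) {ε : ℝ} (hε : ε ∈ Set.Icc (0 : ℝ) 1) (n : ℕ) :
    0 ≤ Fcdf q K ε n :=
  Finset.sum_nonneg fun k _ ↦ mul_nonneg
    (mul_nonneg (mul_nonneg (Nat.cast_nonneg _) (pow_nonneg (sub_nonneg.2 hε.2) _))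
      (pow_nonneg hε.1 _)) (Pdec_nonneg hq K k)

theorem Fcdf_le_succ {q : ℕ} (hq : 1 ≤ q) (K : ℕ) {ε : ℝ} (hε : ε ∈ Set.Icc (0 : ℝ) 1) (n : ℕ) :
    Fcdf q K ε n ≤ Fcdf q K ε (n + 1) := by
  have hp : 0 ≤ 1 - ε := sub_nonneg.2 hε.2
  rw [Fcdf_eq_sum_range, Fcdf_eq_sum_range, sum_choose_mul_succ]
  have h := mul_le_mul_of_nonneg_left (Finset.sum_le_sum fun k (_ : k ∈ Finset.range (n + 1)) ↦
    mul_le_mul_of_nonneg_left (Pdec_le_succ hq K k)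
      (mul_nonneg (mul_nonneg (Nat.cast_nonneg (n.choose k)) (pow_nonneg hp k))
        (pow_nonneg hε.1 (n - k)))) hp
  linarith

theorem fpmf_nonneg (q K : ℕ) (hq : 2 ≤ q) (hK : 1 ≤ K)
    (ε : ℝ) (hε : ε ∈ Set.Icc (0:ℝ) 1) (nT : ℕ) (hnT : K ≤ nT) :
    0 ≤ fpmf q K ε nT := by
  have hq' : 1 ≤ q := by omega
  unfold fpmf
  split_ifs with h
  · exact Fcdf_nonneg hq' K hε K
  · obtain ⟨n, rfl⟩ := Nat.exists_eq_add_of_le' (hK.trans hnT)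
    exact sub_nonneg.2 (Fcdf_le_succ hq' K hε n)
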